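/- An atom of the lattice Com is a neutral element of this lattice if and only if it coincides with one of the varieties SL or ZM. -/

import Mathlib

open FirstOrder

/-! ### Words, identities, and commutative semigroup varieties -/

/-- Semigroup words over the countable alphabet `ℕ`. -/
abbrev SGWord : Type := FreeSemigroup ℕ

/-- A semigroup identity `u = v` is a pair of words. -/
abbrev SGId : Type := SGWord × SGWord

/-- The one-letter word consisting of the letter `n`. -/
def ltr (n : ℕ) : SGWord := FreeSemigroup.of n

/-- `wpow w n` is the word `w^n` (for `n ≥ 1`; by convention `wpow w 0 = w`). -/
def wpow (w : SGWord) : ℕ → SGWord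
  | 0 => w
  | 1 => w
  | n + 2 => wpow w (n + 1) * w

/-- The letter `n` occurs in the word `w`. -/
def OccursIn (n : ℕ) (w : SGWord) : Prop := n = w.head ∨ n ∈ w.tail

/-- A semigroup `S` satisfies the identity `i.1 = i.2` if all evaluations of the two
words in `S` coincide. -/
def SGSatisfies (S : Type) [Semigroup S] (i : SGId) : Prop :=
  ∀ f : ℕ → S, FreeSemigroup.lift f i.1 = FreeSemigroup.lift f i.2

/-- A bundled (nonempty) commutative semigroup. -/
structure ComSG where
  carrier : Type
  [str : CommSemigroup carrier]
  [instNonempty : Nonempty carrier]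

attribute [instance] ComSG.str ComSG.instNonempty

/-- The class of commutative semigroups satisfying every identity in `E`. -/
def modelsOf (E : Set SGId) : Set ComSG := {S | ∀ i ∈ E, SGSatisfies S.carrier i}

/-- The set of identities holding in every member of the class `K`. -/
def theoryOfClass (K : Set ComSG) : Set SGId := {i | ∀ S ∈ K, SGSatisfies S.carrier i}

theorem subset_theoryOfClass_modelsOf (E : Set SGId) : E ⊆ theoryOfClass (modelsOf E) :=
  fun i hi S hS => hS i hi

theorem theoryOfClass_antitone {K K' : Set ComSG} (h : K ⊆ K') :
    theoryOfClass K' ⊆ theoryOfClass K := fun _ hi S hS => hi S (h hS)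

theorem modelsOf_antitone {E E' : Set SGId} (h : E ⊆ E') : modelsOf E' ⊆ modelsOf E :=
  fun _ hS i hi => hS i (h hi)

/-- A variety of commutative semigroups, identified with its (equationally closed)
equational theory.  Varieties are ordered by inclusion of the corresponding classes
of semigroups, i.e. by *reverse* inclusion of theories. -/
structure ComVariety where
  theory : Set SGId
  closed : theoryOfClass (modelsOf theory) = theory

theorem ComVariety.ext' {V W : ComVariety} (h : V.theory = W.theory) : V = W := by
  cases V; cases W; cases h; rfl

instance : PartialOrder ComVariety where
  le V W := W.theory ⊆ V.theory
  le_refl V := subset_rfl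
  le_trans U V W h1 h2 := fun i hi => h1 (h2 hi)
  le_antisymm V W h1 h2 := ComVariety.ext' (subset_antisymm h2 h1)

instance : SupSet ComVariety where
  sSup s :=
    { theory := ⋂ V ∈ s, V.theory
      closed := by
        apply subset_antisymm
        · intro i hi
          refine Set.mem_iInter₂.2 fun V hV => ?_
          have h1 : (⋂ V ∈ s, ComVariety.theory V) ⊆ V.theory := Set.biInter_subset_of_mem hV
          have h2 := theoryOfClass_antitone (modelsOf_antitone h1)
          rw [V.closed] at h2
          exact h2 hi
        · exact subset_theoryOfClass_modelsOf _ }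

/-- The lattice **Com** of all commutative semigroup varieties. -/
instance : CompleteLattice ComVariety :=
  completeLatticeOfSup ComVariety fun s => by
    constructor
    · intro V hV i hi
      exact Set.mem_iInter₂.1 hi V hV
    · intro W hW i hi
      exact Set.mem_iInter₂.2 fun V hV => hW hV hi

/-- The variety of commutative semigroups given by the identity system `E`. -/
def comVar (E : Set SGId) : ComVariety where
  theory := theoryOfClass (modelsOf E)
  closed := by
    apply subset_antisymm
    · exact theoryOfClass_antitone fun S hS i hi => hi S hS
    · exact subset_theoryOfClass_modelsOf _

/-! ### The first-order language of lattices and definability -/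

/-- The first-order language of lattices: two binary function symbols (`true` for the
join `∨` and `false` for the meet `∧`) and nothing else. -/
def latticeLang : Language where
  Functions := fun n => match n with | 2 => Bool | _ => Empty
  Relations := fun _ => Empty

instance latticeLangStructure (L : Type*) [Lattice L] : latticeLang.Structure L where
  funMap {n} f x :=
    match n, f with
    | 2, b => bif b then x 0 ⊔ x 1 else x 0 ⊓ x 1
    | 0, f => f.elim
    | 1, f => f.elim
    | (_ + 3), f => f.elim
  RelMap {n} r _ := r.elim

/-- A subset `A` of a lattice `L` is definable in `L` if there is a first-order formula
`φ(x)` with one free variable in the language of the lattice operations `∨` and `∧`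
such that for every `a ∈ L`, `φ(a)` holds in `L` if and only if `a ∈ A`. -/
def LatDefinable (L : Type*) [Lattice L] (A : Set L) : Prop :=
  ∃ φ : latticeLang.Formula (Fin 1), ∀ a : L, (φ.Realize fun _ => a) ↔ a ∈ A

/-! ### Named varieties -/

/-- The commutativity identity `xy = yx`. -/
def commId : SGId := (ltr 0 * ltr 1, ltr 1 * ltr 0)

/-- The pair of identities abbreviated by the symbolic identity `w = 0`, namely
`wx = w` and `xw = w`, where `x` is the letter `n` (assumed not to occur in `w`). -/
def zeroId (w : SGWord) (n : ℕ) : Set SGId := {(w * ltr n, w), (ltr n * w, w)}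

/-- `A n = var{xⁿy = y, xy = yx}`, the variety of Abelian groups of exponent dividing `n`. -/
def Avar (n : ℕ) : ComVariety := comVar {(wpow (ltr 0) n * ltr 1, ltr 1), commId}

/-- `SL = var{x² = x, xy = yx}`, the variety of semilattices. -/
def SLvar : ComVariety := comVar {(wpow (ltr 0) 2, ltr 0), commId}

/-- `ZM = var{xy = 0}` (within **Com**), the variety of null semigroups. -/
def ZMvar : ComVariety := comVar ({commId} ∪ zeroId (ltr 0 * ltr 1) 2)

/-- `T = var{x = y}`, the trivial variety. -/
def Tvar : ComVariety := comVar {(ltr 0, ltr 1)}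

/-- `COM`, the variety of all commutative semigroups. -/
def COMvar : ComVariety := comVar {commId}

/-- `C m = var{xᵐ = xᵐ⁺¹, xy = yx}` (the variety generated by the cyclic monoid
`⟨a ∣ aᵐ = aᵐ⁺¹⟩`), with the convention `C 0 = T`. -/
def Cvar : ℕ → ComVariety
  | 0 => Tvar
  | m + 1 => comVar {(wpow (ltr 0) (m + 1), wpow (ltr 0) (m + 2)), commId}

/-- `D m = var{xᵐ = 0, xy = yx}`. -/
def Dvar (m : ℕ) : ComVariety := comVar ({commId} ∪ zeroId (wpow (ltr 0) m) 1)

/-- The word `x₁x₂⋯x_k` (in the letters `0, 1, …, k-1`), for `k ≥ 1`. -/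
def chainWord : ℕ → SGWord
  | 0 => ltr 0
  | 1 => ltr 0
  | k + 2 => chainWord (k + 1) * ltr (k + 1)

/-- `N k = var{x² = x₁x₂⋯x_k = 0, xy = yx}`. -/
def Nvar (k : ℕ) : ComVariety :=
  comVar ({commId} ∪ zeroId (wpow (ltr 0) 2) 1 ∪ zeroId (chainWord k) k)

/-- `N_ω = var{x² = 0, xy = yx}`. -/
def Nomegavar : ComVariety := comVar ({commId} ∪ zeroId (wpow (ltr 0) 2) 1)

/-- `N₃ᶜ = var{xyz = 0, xy = yx}`. -/
def N3cvar : ComVariety := comVar ({commId} ∪ zeroId (ltr 0 * ltr 1 * ltr 2) 3)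

/-! ### Semantic notions -/

/-- A semigroup `S` belongs to the variety `V` if it satisfies every identity of `V`. -/
def VMem (S : Type) [Semigroup S] (V : ComVariety) : Prop :=
  ∀ i ∈ V.theory, SGSatisfies S i

/-- `spow a n` is the power `aⁿ` in a semigroup (for `n ≥ 1`; by convention `spow a 0 = a`). -/
def spow {S : Type} [Semigroup S] (a : S) : ℕ → S
  | 0 => a
  | 1 => a
  | n + 2 => spow a (n + 1) * a

/-- A semigroup is a group. -/
def IsGroupSG (S : Type) [Semigroup S] : Prop :=
  ∃ e : S, (∀ a, e * a = a ∧ a * e = a) ∧ ∀ a, ∃ b, a * b = e ∧ b * a = e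

/-- A semigroup is periodic: every element generates a finite cyclic subsemigroup. -/
def IsPeriodicSG (S : Type) [Semigroup S] : Prop :=
  ∀ a : S, ∃ i j : ℕ, 1 ≤ i ∧ i < j ∧ spow a i = spow a j

/-- A semigroup is a nil-semigroup: it has a zero element and every element has a
power equal to zero. -/
def IsNilSG (S : Type) [Semigroup S] : Prop :=
  ∃ z : S, (∀ a, z * a = z ∧ a * z = z) ∧ ∀ a, ∃ n, 1 ≤ n ∧ spow a n = z

/-- A variety all of whose members are groups. -/
def IsGroupVariety (V : ComVariety) : Prop := ∀ S ∈ modelsOf V.theory, IsGroupSG S.carrier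

/-- A variety all of whose members are periodic semigroups. -/
def IsPeriodicVariety (V : ComVariety) : Prop := ∀ S ∈ modelsOf V.theory, IsPeriodicSG S.carrier

/-- A nil-variety: a variety all of whose members are nil-semigroups. -/
def IsNilVariety (V : ComVariety) : Prop := ∀ S ∈ modelsOf V.theory, IsNilSG S.carrier

/-- A combinatorial variety: all groups in it are trivial. -/
def IsCombinatorial (V : ComVariety) : Prop :=
  ∀ S ∈ modelsOf V.theory, IsGroupSG S.carrier → ∀ a b : S.carrier, a = b

/-- `K` is the variety generated by the semigroup `M` (with explicit semigroup
structure `inst`): the smallest variety containing `M`. -/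
def GeneratedBy (M : Type) (inst : Semigroup M) (K : ComVariety) : Prop :=
  IsLeast {W : ComVariety | ∀ i ∈ W.theory, @SGSatisfies M inst i} K

/-- A neutral element of a lattice. -/
def IsNeutralElt {α : Type*} [Lattice α] (x : α) : Prop :=
  ∀ y z, (x ⊔ y) ⊓ (y ⊔ z) ⊓ (z ⊔ x) = (x ⊓ y) ⊔ (y ⊓ z) ⊔ (z ⊓ x)

/-- A chain variety: a variety whose lattice of subvarieties is a chain. -/
def IsChainVariety (V : ComVariety) : Prop :=
  ∀ W₁ W₂ : ComVariety, W₁ ≤ V → W₂ ≤ V → W₁ ≤ W₂ ∨ W₂ ≤ W₁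

/-- A variety is 0-reduced in **Com** if it is given within `COM` by 0-reduced
identities (identities of the form `w = 0`) only. -/
def IsZeroReduced (V : ComVariety) : Prop :=
  ∃ P : Set (SGWord × ℕ), (∀ p ∈ P, ¬ OccursIn p.2 p.1) ∧
    V = comVar (⋃ p ∈ P, zeroId p.1 p.2)

/-- `ZR V`: the least variety 0-reduced in **Com** that contains `V`. -/
def ZRv (V : ComVariety) : ComVariety := sInf {W : ComVariety | IsZeroReduced W ∧ V ≤ W}


open Relation

theorem median_meets_le_median_joins {α : Type*} [Lattice α] (x y z : α) :
    (x ⊓ y) ⊔ (y ⊓ z) ⊔ (z ⊓ x) ≤ (x ⊔ y) ⊓ (y ⊔ z) ⊓ (z ⊔ x) := by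
  refine sup_le (sup_le ?_ ?_) ?_ <;> refine le_inf (le_inf ?_ ?_) ?_ <;>
    first
      | exact inf_le_left.trans le_sup_left
      | exact inf_le_left.trans le_sup_right
      | exact inf_le_right.trans le_sup_left

/-! ### Evaluation of words -/

theorem lift_lift {S : Type} [Semigroup S] (f : ℕ → S) (σ : ℕ → SGWord) (w : SGWord) :
    FreeSemigroup.lift f (FreeSemigroup.lift σ w) =
      FreeSemigroup.lift (fun n => FreeSemigroup.lift f (σ n)) w := by
  induction w using FreeSemigroup.recOnMul with
  | ih1 n => simp
  | ih2 n w _ ih => simp [ih]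

theorem lift_ltr_self (w : SGWord) : FreeSemigroup.lift ltr w = w := by
  induction w using FreeSemigroup.recOnMul with
  | ih1 n => rfl
  | ih2 n w _ ih => rw [map_mul, ih]; rfl

theorem coe_lift_wpow {S : Type} [CommSemigroup S] (f : ℕ → S) (w : SGWord) {n : ℕ}
    (hn : 1 ≤ n) :
    ((FreeSemigroup.lift f (wpow w n) : S) : WithOne S) =
      ((FreeSemigroup.lift f w : S) : WithOne S) ^ n := by
  induction n, hn using Nat.le_induction with
  | base => simp [wpow]
  | succ n hn ih =>
    obtain ⟨k, rfl⟩ : ∃ k, n = k + 1 := ⟨n - 1, by omega⟩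
    rw [wpow, map_mul, WithOne.coe_mul, ih, ← pow_succ]

theorem one_le_length (w : SGWord) : 1 ≤ w.length := Nat.succ_le_succ (Nat.zero_le _)

theorem length_eq_one_or (w : SGWord) : (∃ n, w = ltr n) ∨ ∃ a b, w = a * b := by
  induction w using FreeSemigroup.recOnMul with
  | ih1 n => exact .inl ⟨n, rfl⟩
  | ih2 n w _ _ => exact .inr ⟨_, _, rfl⟩

theorem two_le_length_mul (a b : SGWord) : 2 ≤ (a * b).length := by
  have := one_le_length a
  have := one_le_length b
  rw [FreeSemigroup.length_mul]; omega

theorem exists_eq_mul_of_two_le_length {w : SGWord} (h : 2 ≤ w.length) : ∃ a b, w = a * b := by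
  rcases length_eq_one_or w with ⟨n, rfl⟩ | h'
  · simp [ltr] at h
  · exact h'

theorem exists_eq_ltr_of_length_lt_two {w : SGWord} (h : w.length < 2) : ∃ n, w = ltr n := by
  rcases length_eq_one_or w with h' | ⟨a, b, rfl⟩
  · exact h'
  · exact absurd (two_le_length_mul a b) (by omega)

theorem length_wpow (w : SGWord) {n : ℕ} (hn : 1 ≤ n) :
    (wpow w n).length = n * w.length := by
  induction n, hn using Nat.le_induction with
  | base => simp [wpow]
  | succ n hn ih =>
    obtain ⟨k, rfl⟩ : ∃ k, n = k + 1 := ⟨n - 1, by omega⟩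
    rw [wpow, FreeSemigroup.length_mul, ih]; ring

theorem le_length_wpow (w : SGWord) {n : ℕ} (hn : 1 ≤ n) : n ≤ (wpow w n).length := by
  rw [length_wpow w hn]
  exact Nat.le_mul_of_pos_right _ (one_le_length w)

theorem length_le_length_lift (σ : ℕ → SGWord) (w : SGWord) :
    w.length ≤ (FreeSemigroup.lift σ w).length := by
  induction w using FreeSemigroup.recOnMul with
  | ih1 n => simpa using one_le_length (σ n)
  | ih2 n w _ ih =>
    have := one_le_length (σ n)
    rw [FreeSemigroup.lift_of_mul]
    simp only [FreeSemigroup.length_mul, FreeSemigroup.length_of]; omega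

theorem coe_lift_const {S : Type} [CommSemigroup S] (a : S) (w : SGWord) :
    ((FreeSemigroup.lift (fun _ => a) w : S) : WithOne S) = (a : WithOne S) ^ w.length := by
  induction w using FreeSemigroup.recOnMul with
  | ih1 n => simp
  | ih2 n w _ ih => rw [FreeSemigroup.lift_of_mul, WithOne.coe_mul, ih]; simp [pow_add]

@[simp] theorem occursIn_ltr (n m : ℕ) : OccursIn n (ltr m) ↔ n = m := by
  simp [OccursIn, ltr]

@[simp] theorem occursIn_of (n m : ℕ) : OccursIn n (FreeSemigroup.of m) ↔ n = m :=
  occursIn_ltr n m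

@[simp] theorem occursIn_mul (n : ℕ) (u v : SGWord) :
    OccursIn n (u * v) ↔ OccursIn n u ∨ OccursIn n v := by
  simp [OccursIn, or_assoc]

theorem occursIn_wpow (x : ℕ) (w : SGWord) (n : ℕ) : OccursIn x (wpow w n) ↔ OccursIn x w := by
  induction n with
  | zero => rfl
  | succ n ih =>
    cases n with
    | zero => rfl
    | succ n => rw [wpow, occursIn_mul, ih, or_self]

/-! ### Equational theories of commutative semigroup varieties -/

namespace ComVariety

variable (V W : ComVariety)

variable {V} in
theorem lift_eq {u v : SGWord} (h : (u, v) ∈ V.theory) {S : ComSG}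
    (hS : S ∈ modelsOf V.theory) (f : ℕ → S.carrier) :
    FreeSemigroup.lift f u = FreeSemigroup.lift f v := hS _ h f

theorem mem_of_lift_eq {u v : SGWord} (h : ∀ S ∈ modelsOf V.theory, ∀ f : ℕ → S.carrier,
    FreeSemigroup.lift f u = FreeSemigroup.lift f v) : (u, v) ∈ V.theory := by
  rw [← V.closed]; exact h

theorem refl (u : SGWord) : (u, u) ∈ V.theory := V.mem_of_lift_eq fun _ _ _ => rfl

theorem mul_comm_mem (u v : SGWord) : (u * v, v * u) ∈ V.theory :=
  V.mem_of_lift_eq fun _ _ _ => by rw [map_mul, map_mul, mul_comm]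

variable {V W}

theorem symm {u v : SGWord} (h : (u, v) ∈ V.theory) : (v, u) ∈ V.theory :=
  V.mem_of_lift_eq fun _ hS f => (lift_eq h hS f).symm

theorem trans {u v w : SGWord} (h : (u, v) ∈ V.theory) (h' : (v, w) ∈ V.theory) :
    (u, w) ∈ V.theory :=
  V.mem_of_lift_eq fun _ hS f => (lift_eq h hS f).trans (lift_eq h' hS f)

theorem mul {u v u' v' : SGWord} (h : (u, v) ∈ V.theory) (h' : (u', v') ∈ V.theory) :
    (u * u', v * v') ∈ V.theory :=
  V.mem_of_lift_eq fun _ hS f => by rw [map_mul, map_mul, lift_eq h hS, lift_eq h' hS]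

theorem mul_right {u v : SGWord} (h : (u, v) ∈ V.theory) (w : SGWord) :
    (u * w, v * w) ∈ V.theory := mul h (V.refl w)

theorem subst {u v : SGWord} (h : (u, v) ∈ V.theory) (σ : ℕ → SGWord) :
    (FreeSemigroup.lift σ u, FreeSemigroup.lift σ v) ∈ V.theory :=
  V.mem_of_lift_eq fun _ hS f => by rw [lift_lift, lift_lift, lift_eq h hS]

theorem wpow_mem {u v : SGWord} (h : (u, v) ∈ V.theory) (n : ℕ) :
    (wpow u n, wpow v n) ∈ V.theory := by
  induction n with
  | zero => exact h
  | succ n ih =>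
    cases n with
    | zero => exact h
    | succ n => exact mul ih h

theorem lift_const {u v : SGWord} (h : (u, v) ∈ V.theory) (a : SGWord) :
    (FreeSemigroup.lift (fun _ => a) u, FreeSemigroup.lift (fun _ => a) v) ∈ V.theory :=
  subst h _

theorem le_def : V ≤ W ↔ W.theory ⊆ V.theory := Iff.rfl

theorem not_le_iff : ¬ V ≤ W ↔ ∃ u v, (u, v) ∈ W.theory ∧ (u, v) ∉ V.theory := by
  rw [le_def, Set.not_subset]
  exact ⟨fun ⟨⟨u, v⟩, h⟩ => ⟨u, v, h⟩, fun ⟨u, v, h⟩ => ⟨(u, v), h⟩⟩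

theorem mem_sup {i : SGId} : i ∈ (V ⊔ W).theory ↔ i ∈ V.theory ∧ i ∈ W.theory := by
  constructor
  · exact fun h => ⟨(le_sup_left : V ≤ V ⊔ W) h, (le_sup_right : W ≤ V ⊔ W) h⟩
  · rw [← sSup_pair]
    rintro ⟨h, h'⟩
    refine Set.mem_iInter₂.2 ?_
    rintro X (rfl | rfl)
    exacts [h, h']

theorem mem_inf_left {i : SGId} (h : i ∈ V.theory) : i ∈ (V ⊓ W).theory :=
  (inf_le_left : V ⊓ W ≤ V) h

theorem mem_inf_right {i : SGId} (h : i ∈ W.theory) : i ∈ (V ⊓ W).theory :=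
  (inf_le_right : V ⊓ W ≤ W) h

theorem eq_bot_iff_mem : V = ⊥ ↔ (ltr 0, ltr 1) ∈ V.theory := by
  constructor
  · rintro rfl
    exact (bot_le : (⊥ : ComVariety) ≤ Tvar) (subset_theoryOfClass_modelsOf _ rfl)
  · intro h
    refine le_bot_iff.1 fun i _ => V.mem_of_lift_eq fun S hS f => ?_
    simpa [ltr] using lift_eq h hS
      (fun n => if n = 0 then FreeSemigroup.lift f i.1 else FreeSemigroup.lift f i.2)

/-- The variety whose theory is the transitive closure of a symmetric fully invariant compatible
relation on words that contains all commutations. -/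
def ofRel (R : SGWord → SGWord → Prop) (hsymm : ∀ u v, R u v → R v u)
    (hmul : ∀ u v w, R u v → R (u * w) (v * w)) (hcomm : ∀ u v, R (u * v) (v * u))
    (hsubst : ∀ (σ : ℕ → SGWord) u v, R u v →
      R (FreeSemigroup.lift σ u) (FreeSemigroup.lift σ v)) : ComVariety where
  theory := {i | ReflTransGen R i.1 i.2}
  closed := by
    have mul_r {u v} (w) (h : ReflTransGen R u v) : ReflTransGen R (u * w) (v * w) :=
      h.lift (· * w) fun a b => hmul a b w
    have mul_l {u v} (w) (h : ReflTransGen R u v) : ReflTransGen R (w * u) (w * v) :=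
      ((ReflTransGen.single (hcomm w u)).trans (mul_r w h)).tail (hcomm v w)
    have subst {u v} (σ) (h : ReflTransGen R u v) :
        ReflTransGen R (FreeSemigroup.lift σ u) (FreeSemigroup.lift σ v) :=
      h.lift _ fun a b => hsubst σ a b
    let c : Con SGWord :=
      { r := ReflTransGen R
        iseqv := ⟨fun _ => .refl, fun h => have : Std.Symm R := ⟨hsymm⟩; ReflTransGen.stdSymm.symm _ _ h,
          ReflTransGen.trans⟩
        mul' := fun h h' => (mul_r _ h).trans (mul_l _ h') }
    refine subset_antisymm (fun i hi => ?_) (subset_theoryOfClass_modelsOf _)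
    let inst : CommSemigroup c.Quotient :=
      { (inferInstance : Semigroup c.Quotient) with
        mul_comm := by
          rintro ⟨a⟩ ⟨b⟩
          exact (Con.eq c).2 (.single (hcomm a b)) }
    have eval (σ : ℕ → SGWord) (w : SGWord) :
        FreeSemigroup.lift (fun n => ((σ n : SGWord) : c.Quotient)) w =
          (FreeSemigroup.lift σ w : SGWord) := by
      induction w using FreeSemigroup.recOnMul with
      | ih1 n => rfl
      | ih2 n w _ ih => simp [ih]
    have model : (@ComSG.mk c.Quotient inst ⟨(ltr 0 : SGWord)⟩) ∈
        modelsOf {i | ReflTransGen R i.1 i.2} := by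
      intro j hj f
      choose σ hσ using fun n => Quotient.exists_rep (f n)
      obtain rfl : f = fun n => ((σ n : SGWord) : c.Quotient) := (funext hσ).symm
      exact (eval σ _).trans (((Con.eq c).2 (subst σ hj)).trans (eval σ _).symm)
    have h := ((eval ltr _).symm.trans (hi _ model fun n => ((ltr n : SGWord) : c.Quotient))).trans
      (eval ltr _)
    rw [lift_ltr_self, lift_ltr_self] at h
    exact (Con.eq c).1 h

theorem reflTransGen_of_mem_inf {u v : SGWord} (h : (u, v) ∈ (V ⊓ W).theory) :
    ReflTransGen (fun a b => (a, b) ∈ V.theory ∨ (a, b) ∈ W.theory) u v := by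
  let X := ofRel (fun a b => (a, b) ∈ V.theory ∨ (a, b) ∈ W.theory)
    (fun _ _ => Or.imp symm symm) (fun _ _ w => Or.imp (mul_right · w) (mul_right · w))
    (fun u v => .inl (V.mul_comm_mem u v)) (fun σ _ _ => Or.imp (subst · σ) (subst · σ))
  exact (le_inf (fun i hi => .single (.inl hi)) (fun i hi => .single (.inr hi)) : X ≤ V ⊓ W) h

theorem inf_induction (P : SGWord → Prop) (hV : ∀ a b, (a, b) ∈ V.theory → P a → P b)
    (hW : ∀ a b, (a, b) ∈ W.theory → P a → P b) {u v : SGWord}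
    (h : (u, v) ∈ (V ⊓ W).theory) (hu : P u) : P v := by
  have h' := reflTransGen_of_mem_inf h
  clear h
  induction h' with
  | refl => exact hu
  | tail _ hbc ih => exact hbc.elim (hV _ _ · ih) (hW _ _ · ih)

theorem inf_theory_subset {X : ComVariety} {r : SGWord → SGWord}
    (hV : ∀ a b, (a, b) ∈ V.theory → (r a, r b) ∈ X.theory)
    (hW : ∀ a b, (a, b) ∈ W.theory → (r a, r b) ∈ X.theory) {u v : SGWord}
    (h : (u, v) ∈ (V ⊓ W).theory) : (r u, r v) ∈ X.theory :=
  inf_induction (fun w => (r u, r w) ∈ X.theory) (fun a b hab h => trans h (hV a b hab))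
    (fun a b hab h => trans h (hW a b hab)) h (X.refl _)

/-- A criterion for neutrality: any failure of the median identity can be tested on pairs of
varieties not both containing `X`. -/
theorem isNeutralElt_of {X : ComVariety}
    (h₁ : ∀ Y Z : ComVariety, X ≤ Y → ¬ X ≤ Z → ∀ u v, (u, v) ∈ X.theory →
      (u, v) ∈ (Y ⊓ Z).theory → (u, v) ∈ (Y ⊓ (Z ⊔ X)).theory)
    (h₂ : ∀ Y Z D : ComVariety, ¬ X ≤ Y → ¬ X ≤ Z → D ≤ X ⊔ Y → D ≤ Y ⊔ Z → D ≤ Z ⊔ X →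
      ∀ u v, (u, v) ∈ Y.theory → (u, v) ∈ D.theory) : IsNeutralElt X := by
  have key (Y Z : ComVariety) (hY : X ≤ Y) (hZ : ¬ X ≤ Z) :
      Y ⊓ (Z ⊔ X) ≤ X ⊔ (Y ⊓ Z) := by
    intro i hi
    rw [mem_sup] at hi
    exact h₁ Y Z hY hZ _ _ hi.1 hi.2
  have key₂ (Y Z D : ComVariety) (hY : ¬ X ≤ Y) (hZ : ¬ X ≤ Z) (hXY : D ≤ X ⊔ Y)
      (hYZ : D ≤ Y ⊔ Z) (hZX : D ≤ Z ⊔ X) : D ≤ Y ⊓ Z :=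
    le_inf (fun i hi => h₂ Y Z D hY hZ hXY hYZ hZX _ _ hi) fun i hi =>
      h₂ Z Y D hZ hY (hZX.trans (sup_comm Z X).le) (hYZ.trans (sup_comm Y Z).le)
        (hXY.trans (sup_comm X Y).le) _ _ hi
  intro y z
  apply le_antisymm
  · by_cases hy : X ≤ y <;> by_cases hz : X ≤ z
    · simp only [sup_eq_right.2 hy, sup_eq_left.2 hz, inf_eq_left.2 hy, inf_eq_right.2 hz]
      exact le_sup_of_le_left (le_sup_of_le_right (le_inf
        (inf_le_left.trans inf_le_left) inf_le_right))
    · rw [sup_eq_right.2 hy, inf_eq_left.2 hy]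
      exact (le_inf (inf_le_left.trans inf_le_left) inf_le_right).trans
        ((key y z hy hz).trans le_sup_left)
    · rw [sup_eq_left.2 hz, inf_eq_right.2 hz]
      calc _ ≤ z ⊓ (y ⊔ X) := le_inf inf_le_right
              (inf_le_left.trans (inf_le_left.trans (sup_comm X y).le))
        _ ≤ X ⊔ (z ⊓ y) := key z y hz hy
        _ ≤ _ := sup_le le_sup_right (le_sup_of_le_left (le_sup_of_le_right (inf_comm z y).le))
    · exact (key₂ y z _ hy hz
        (inf_le_left.trans inf_le_left) (inf_le_left.trans inf_le_right) inf_le_right).trans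
        (le_sup_of_le_left le_sup_right)
  · exact median_meets_le_median_joins X y z

end ComVariety
/-! ### The variety of null semigroups -/

namespace ComVariety

variable {V W : ComVariety}

theorem mem_ZMvar {u v : SGWord} :
    (u, v) ∈ ZMvar.theory ↔ u = v ∨ (2 ≤ u.length ∧ 2 ≤ v.length) := by
  constructor
  · intro h
    let inst : CommSemigroup (Option ℕ) :=
      { mul := fun _ _ => none, mul_assoc := fun _ _ _ => rfl, mul_comm := fun _ _ => rfl }
    have model : (@ComSG.mk (Option ℕ) inst ⟨none⟩) ∈
        modelsOf ({commId} ∪ zeroId (ltr 0 * ltr 1) 2) := by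
      rintro i (rfl | rfl | rfl) f <;> rfl
    have eval_mul (a b : SGWord) :
        @FreeSemigroup.lift ℕ (Option ℕ) inst.toSemigroup some (a * b) = none :=
      map_mul (@FreeSemigroup.lift ℕ (Option ℕ) inst.toSemigroup some) a b
    have eval_ltr (n : ℕ) :
        @FreeSemigroup.lift ℕ (Option ℕ) inst.toSemigroup some (ltr n) = some n := rfl
    have h := h _ model some
    change @FreeSemigroup.lift ℕ (Option ℕ) inst.toSemigroup some u =
      @FreeSemigroup.lift ℕ (Option ℕ) inst.toSemigroup some v at h
    rcases length_eq_one_or u with ⟨n, rfl⟩ | ⟨a, b, rfl⟩ <;>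
      rcases length_eq_one_or v with ⟨m, rfl⟩ | ⟨c, d, rfl⟩
    · rw [eval_ltr, eval_ltr, Option.some.injEq] at h
      exact .inl (congrArg ltr h)
    · rw [eval_ltr, eval_mul] at h; cases h
    · rw [eval_ltr, eval_mul] at h; cases h
    · exact .inr ⟨two_le_length_mul a b, two_le_length_mul c d⟩
  · rintro (rfl | ⟨hu, hv⟩)
    · exact ZMvar.refl u
    obtain ⟨a, b, rfl⟩ := exists_eq_mul_of_two_le_length hu
    obtain ⟨c, d, rfl⟩ := exists_eq_mul_of_two_le_length hv
    intro S hS f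
    have absorb (x y z : S.carrier) : x * y * z = x * y :=
      hS (ltr 0 * ltr 1 * ltr 2, ltr 0 * ltr 1) (.inr (.inl rfl)) fun n =>
        if n = 0 then x else if n = 1 then y else z
    simp only [map_mul]
    rw [← absorb _ _ (FreeSemigroup.lift f c * FreeSemigroup.lift f d), mul_comm, absorb]

theorem mem_of_coe_lift_eq {u v : SGWord}
    (h : ∀ S ∈ modelsOf V.theory, ∀ f : ℕ → S.carrier,
      ((FreeSemigroup.lift f u : S.carrier) : WithOne S.carrier) =
        (FreeSemigroup.lift f v : S.carrier)) : (u, v) ∈ V.theory :=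
  V.mem_of_lift_eq fun S hS f => WithOne.coe_injective (h S hS f)

theorem exists_wpow_mem_of_ltr {n : ℕ} {v : SGWord} (h : (ltr n, v) ∈ V.theory)
    (hv : ltr n ≠ v) : ∃ k, 2 ≤ k ∧ ∀ w, (w, wpow w k) ∈ V.theory := by
  by_cases hl : v.length < 2
  · obtain ⟨m, rfl⟩ := exists_eq_ltr_of_length_lt_two hl
    have hmn : m ≠ n := fun e => hv (by rw [e])
    refine ⟨2, le_rfl, fun w => ?_⟩
    simpa [ltr, hmn] using subst h fun i => if i = n then w else wpow w 2
  · refine ⟨v.length, not_lt.1 hl, fun w => ?_⟩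
    refine trans (by simpa [ltr] using lift_const h w) (mem_of_coe_lift_eq fun S _ f => ?_)
    rw [lift_lift, coe_lift_const, coe_lift_wpow f w (one_le_length v)]

theorem exists_wpow_mem_of_not_ZMvar_le (h : ¬ ZMvar ≤ V) :
    ∃ k, 2 ≤ k ∧ ∀ w, (w, wpow w k) ∈ V.theory := by
  obtain ⟨u, v, huv, hn⟩ := not_le_iff.1 h
  rw [mem_ZMvar, not_or, not_and_or, not_le, not_le] at hn
  obtain ⟨hne, hu | hv⟩ := hn
  · obtain ⟨n, rfl⟩ := exists_eq_ltr_of_length_lt_two hu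
    exact exists_wpow_mem_of_ltr huv hne
  · obtain ⟨n, rfl⟩ := exists_eq_ltr_of_length_lt_two hv
    exact exists_wpow_mem_of_ltr (symm huv) (Ne.symm hne)

theorem wpow_mem_of_wpow_mem {m : ℕ} (h : ∀ w, (w, wpow w (m + 1)) ∈ V.theory) (k : ℕ)
    (w : SGWord) : (w, wpow w (k * m + 1)) ∈ V.theory := by
  refine mem_of_coe_lift_eq fun S hS f => ?_
  have h := congrArg (WithOne.coe : S.carrier → WithOne S.carrier) (lift_eq (h w) hS f)
  simp only [coe_lift_wpow f w (Nat.le_add_left 1 _)] at h ⊢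
  induction k with
  | zero => simp
  | succ k ih => rw [Nat.succ_mul, add_right_comm, pow_add, ← ih, ← pow_succ', ← h]

theorem isNeutralElt_ZMvar : IsNeutralElt ZMvar := by
  have pow_pow_mem {a b : SGWord} {n : ℕ} (hn : 2 ≤ n) :
      (wpow a n, wpow b n) ∈ ZMvar.theory :=
    mem_ZMvar.2 (.inr ⟨hn.trans (le_length_wpow a (by omega)),
      hn.trans (le_length_wpow b (by omega))⟩)
  refine isNeutralElt_of (fun Y Z hY hZ u v hX h => ?_)
    fun Y Z D hY hZ hXY hYZ hZX u v h => ?_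
  · rw [mem_ZMvar] at hX
    obtain rfl | ⟨hu, hv⟩ := hX
    · exact refl _ _
    obtain ⟨n, hn, hZn⟩ := exists_wpow_mem_of_not_ZMvar_le hZ
    have hpow (w : SGWord) (hw : 2 ≤ w.length) :
        (w, wpow w n) ∈ (Y ⊓ (Z ⊔ ZMvar)).theory :=
      mem_inf_right (mem_sup.2 ⟨hZn w,
        mem_ZMvar.2 (.inr ⟨hw, hn.trans (le_length_wpow w (by omega))⟩)⟩)
    refine trans (hpow u hu) (trans ?_ (symm (hpow v hv)))
    exact inf_theory_subset (fun a b hab => mem_inf_left (wpow_mem hab n))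
      (fun a b hab => mem_inf_right (mem_sup.2 ⟨wpow_mem hab n, pow_pow_mem hn⟩)) h
  · obtain ⟨n, hn, hYn⟩ := exists_wpow_mem_of_not_ZMvar_le hY
    obtain ⟨m, hm, hZm⟩ := exists_wpow_mem_of_not_ZMvar_le hZ
    obtain ⟨n, rfl⟩ := Nat.exists_eq_add_of_le' (show 1 ≤ n by omega)
    obtain ⟨m, rfl⟩ := Nat.exists_eq_add_of_le' (show 1 ≤ m by omega)
    have hpow (w : SGWord) : (w, wpow w (n * m + 1)) ∈ D.theory :=
      hYZ (mem_sup.2 ⟨mul_comm m n ▸ wpow_mem_of_wpow_mem hYn m w,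
        wpow_mem_of_wpow_mem hZm n w⟩)
    have hnm : 2 ≤ n * m + 1 := by
      have := Nat.mul_le_mul (show 1 ≤ n by omega) (show 1 ≤ m by omega)
      omega
    exact trans (hpow u) (trans (hXY (mem_sup.2 ⟨pow_pow_mem hnm, wpow_mem h _⟩)) (symm (hpow v)))

end ComVariety
/-! ### The variety of semilattices -/

theorem occursIn_head (w : SGWord) : OccursIn w.head w := .inl rfl

theorem occursIn_lift (σ : ℕ → SGWord) (w : SGWord) (x : ℕ) :
    OccursIn x (FreeSemigroup.lift σ w) ↔ ∃ m, OccursIn m w ∧ OccursIn x (σ m) := by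
  induction w using FreeSemigroup.recOnMul with
  | ih1 n => simp
  | ih2 n w _ ih => simp [ih, or_and_right, exists_or]

theorem lift_congr {S : Type} [Semigroup S] {f g : ℕ → S} {w : SGWord}
    (h : ∀ n, OccursIn n w → f n = g n) : FreeSemigroup.lift f w = FreeSemigroup.lift g w := by
  induction w using FreeSemigroup.recOnMul with
  | ih1 n => exact h n (by simp)
  | ih2 n w _ ih =>
    rw [FreeSemigroup.lift_of_mul, FreeSemigroup.lift_of_mul, h n (by simp),
      ih fun m hm => h m (by simp [hm])]

theorem lift_mul_idempotent {S : Type} [CommSemigroup S] (f : ℕ → S) {e : S} (he : e * e = e)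
    {x : ℕ} {w : SGWord} (hx : OccursIn x w) :
    FreeSemigroup.lift (fun n => if n = x then f n * e else f n) w =
      FreeSemigroup.lift f w * e := by
  induction w using FreeSemigroup.recOnMul with
  | ih1 n => simp_all
  | ih2 n w _ ih =>
    rw [FreeSemigroup.lift_of_mul, FreeSemigroup.lift_of_mul]
    by_cases hw : OccursIn x w
    · rw [ih hw]
      split_ifs
      · rw [mul_mul_mul_comm, he]
      · rw [mul_assoc]
    · obtain rfl : x = n := by simpa [hw] using hx
      have hne (n : ℕ) (hn : OccursIn n w) : n ≠ x := fun h => hw (h ▸ hn)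
      rw [if_pos rfl, lift_congr (g := f) fun n hn => if_neg (hne n hn)]
      exact mul_right_comm _ _ _

theorem exists_coe_lift_ite_eq (w : SGWord) (x : ℕ) : ∃ i j : ℕ, (OccursIn x w → 1 ≤ i) ∧
    (¬ OccursIn x w → i = 0) ∧ ∀ (S : Type) [CommSemigroup S] (a b : S),
      ((FreeSemigroup.lift (fun n => if n = x then a else b) w : S) : WithOne S) =
        (a : WithOne S) ^ i * (b : WithOne S) ^ j := by
  induction w using FreeSemigroup.recOnMul with
  | ih1 n =>
    by_cases h : n = x
    · exact ⟨1, 0, by simp, by simp [h], by simp [h]⟩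
    · exact ⟨0, 1, by simp [Ne.symm h], by simp, by simp [h]⟩
  | ih2 n w _ ih =>
    obtain ⟨i, j, h₁, h₂, h₃⟩ := ih
    by_cases h : n = x
    · refine ⟨i + 1, j, by simp, by simp [h], fun S _ a b => ?_⟩
      rw [FreeSemigroup.lift_of_mul, if_pos h, WithOne.coe_mul, h₃, pow_succ', mul_assoc]
    · refine ⟨i, j + 1, by simpa [Ne.symm h] using h₁, by simpa [Ne.symm h] using h₂,
        fun S _ a b => ?_⟩
      rw [FreeSemigroup.lift_of_mul, if_neg h, WithOne.coe_mul, h₃, pow_succ', mul_left_comm]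

theorem coe_pow_eq_coe_pow {S : Type} [CommSemigroup S] {i j k : ℕ} (hi : 1 ≤ i)
    (h : ∀ a b : S, (a : WithOne S) ^ i * (b : WithOne S) ^ (j + 1) = (b : WithOne S) ^ (k + 1))
    (a b : S) : (a : WithOne S) ^ (i * (i + j + 1)) = (b : WithOne S) ^ (i * (i + j + 1)) := by
  have hshift (b : S) (m : ℕ) : (b : WithOne S) ^ (i + j + 1 + m) = b ^ (i + j + 1 + m + i) := by
    have h₁ := h b b
    have h₂ := h (b * b) b
    rw [WithOne.coe_mul, ← sq, ← pow_mul, ← pow_add, ← h₁, ← pow_add] at h₂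
    calc (b : WithOne S) ^ (i + j + 1 + m) = b ^ (i + (j + 1)) * b ^ m := by
            rw [← pow_add, add_assoc i]
      _ = _ := by rw [← h₂, ← pow_add]; congr 1; ring
  have hperiod (b : S) (r : ℕ) :
      (b : WithOne S) ^ (i * (i + j + 1)) = b ^ (i * (i + j + 1) + r * i) := by
    induction r with
    | zero => simp
    | succ r ih =>
      obtain ⟨m, hm⟩ := Nat.exists_eq_add_of_le
        ((Nat.le_mul_of_pos_left (i + j + 1) hi).trans (Nat.le_add_right _ (r * i)))
      rw [ih, hm, hshift, ← hm]; congr 1; ring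
  set N := i * (i + j + 1) with hN
  have hidem (b : S) (r : ℕ) : ((b : WithOne S) ^ (r + 1)) ^ N = b ^ N := by
    have : IsIdempotentElem ((b : WithOne S) ^ N) := by
      rw [IsIdempotentElem, ← pow_add]
      conv_rhs => rw [hperiod b (i + j + 1)]
      rw [mul_comm (i + j + 1) i]
    rw [← pow_mul, mul_comm, pow_mul, this.pow_succ_eq]
  have hmul (a b : S) : (a : WithOne S) ^ N * b ^ N = b ^ N := by
    have := congrArg (· ^ N) (h a b)
    obtain ⟨i', rfl⟩ := Nat.exists_eq_add_of_le' hi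
    simpa only [mul_pow, hidem] using this
  rw [← hmul b a, mul_comm, hmul a b]

namespace ComVariety

variable {V W : ComVariety}

theorem mem_SLvar {u v : SGWord} :
    (u, v) ∈ SLvar.theory ↔ ∀ x, OccursIn x u ↔ OccursIn x v := by
  constructor
  · intro h x
    let inst : CommSemigroup Prop :=
      { mul := Or, mul_assoc := fun _ _ _ => propext or_assoc,
        mul_comm := fun _ _ => propext or_comm }
    have model : (@ComSG.mk Prop inst ⟨True⟩) ∈ modelsOf {(wpow (ltr 0) 2, ltr 0), commId} := by
      rintro i (rfl | rfl) f
      · exact propext (or_self_iff (a := f 0))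
      · exact propext (or_comm (a := f 0) (b := f 1))
    have eval (w : SGWord) :
        @FreeSemigroup.lift ℕ Prop inst.toSemigroup (fun n => x = n) w = OccursIn x w := by
      induction w using FreeSemigroup.recOnMul with
      | ih1 n => simp
      | ih2 n w _ ih =>
        rw [FreeSemigroup.lift_of_mul, ih, occursIn_mul, occursIn_of]; rfl
    exact ((eval u).symm.trans ((h _ model fun n => x = n).trans (eval v))).to_iff
  · intro h S hS f
    have idem (a : S.carrier) : a * a = a := hS (wpow (ltr 0) 2, ltr 0) (.inl rfl) fun _ => a
    have key (s : S.carrier) (w : SGWord) :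
        s * FreeSemigroup.lift f w = s ↔ ∀ n, OccursIn n w → s * f n = s := by
      induction w using FreeSemigroup.recOnMul with
      | ih1 n => simp
      | ih2 n w _ ih =>
        simp only [FreeSemigroup.lift_of_mul, occursIn_mul, occursIn_of, forall_eq_or_imp, ← ih]
        constructor
        · intro h
          constructor
          · rw [← h, mul_assoc, mul_right_comm, idem]
          · rw [← h, mul_assoc, mul_assoc, idem]
        · rintro ⟨h, h'⟩
          rw [← mul_assoc, h, h']
    have h₁ := (key (FreeSemigroup.lift f u) v).2 fun n hn =>
      (key _ u).1 (idem _) n ((h n).2 hn)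
    have h₂ := (key (FreeSemigroup.lift f v) u).2 fun n hn =>
      (key _ v).1 (idem _) n ((h n).1 hn)
    exact h₁.symm.trans ((mul_comm _ _).trans h₂)

theorem exists_wpow_const_of_not_SLvar_le (h : ¬ SLvar ≤ V) :
    ∃ N, 1 ≤ N ∧ ∀ s t, (wpow s N, wpow t N) ∈ V.theory := by
  obtain ⟨u, v, huv, x, hu, hv⟩ :
      ∃ u v, (u, v) ∈ V.theory ∧ ∃ x, OccursIn x u ∧ ¬ OccursIn x v := by
    obtain ⟨u, v, huv, hn⟩ := not_le_iff.1 h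
    rw [mem_SLvar, not_forall] at hn
    obtain ⟨x, hx⟩ := hn
    by_cases hu : OccursIn x u
    · exact ⟨u, v, huv, x, hu, fun hv => hx (iff_of_true hu hv)⟩
    · exact ⟨v, u, symm huv, x, by_contra fun hv => hx (iff_of_false hu hv), hu⟩
  obtain ⟨i, j, hi, -, hij⟩ := exists_coe_lift_ite_eq u x
  obtain ⟨_, k, -, hk, hvk⟩ := exists_coe_lift_ite_eq v x
  obtain rfl := hk hv
  have hi := hi hu
  have hN : 1 ≤ i * (i + j + 1) := Nat.mul_pos hi (Nat.succ_pos _)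
  refine ⟨i * (i + j + 1), hN, fun s t => mem_of_coe_lift_eq fun S hS f => ?_⟩
  rw [coe_lift_wpow f s hN, coe_lift_wpow f t hN]
  refine coe_pow_eq_coe_pow (k := k) hi (fun a b => ?_) _ _
  have := congrArg (WithOne.coe : S.carrier → WithOne S.carrier)
    (lift_eq huv hS fun n => if n = x then a else b)
  rw [hij, hvk, pow_zero, one_mul] at this
  rw [pow_succ, ← mul_assoc, this, ← pow_succ]

theorem wpow_const_mul {N M : ℕ} (hN : 1 ≤ N) (hM : 1 ≤ M)
    (h : ∀ s t, (wpow s N, wpow t N) ∈ V.theory) (s t : SGWord) :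
    (wpow s (M * N), wpow t (M * N)) ∈ V.theory := by
  have key (w : SGWord) : (wpow w (M * N), wpow (wpow w M) N) ∈ V.theory :=
    mem_of_coe_lift_eq fun S _ f => by
      rw [coe_lift_wpow f w (Nat.mul_pos hM hN), coe_lift_wpow f _ hN, coe_lift_wpow f w hM,
        pow_mul]
  exact trans (key s) (trans (h _ _) (symm (key t)))

theorem mem_mul_wpow {N : ℕ} (hN : 1 ≤ N) (h : ∀ s t, (wpow s N, wpow t N) ∈ V.theory)
    {u v : SGWord} (huv : (u, v) ∈ V.theory) (hn : (u, v) ∉ SLvar.theory) (w : SGWord) :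
    (u, u * wpow w N) ∈ V.theory := by
  have key {u v : SGWord} {x : ℕ} (huv : (u, v) ∈ V.theory) (hu : OccursIn x u)
      (hv : ¬ OccursIn x v) : (u, u * wpow w N) ∈ V.theory := by
    refine V.mem_of_lift_eq fun S hS f => ?_
    have he : FreeSemigroup.lift f (wpow w N) * FreeSemigroup.lift f (wpow w N) =
        FreeSemigroup.lift f (wpow w N) := by
      refine Eq.trans (WithOne.coe_injective ?_) (lift_eq (h (w * w) w) hS f)
      rw [WithOne.coe_mul, coe_lift_wpow f _ hN, coe_lift_wpow f _ hN, map_mul, WithOne.coe_mul,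
        mul_pow]
    rw [map_mul, ← lift_mul_idempotent f he hu, lift_eq huv hS, lift_eq huv hS]
    have hne (n : ℕ) (hn : OccursIn n v) : n ≠ x := fun h => hv (h ▸ hn)
    exact lift_congr fun n hn => (if_neg (hne n hn)).symm
  rw [mem_SLvar, not_forall] at hn
  obtain ⟨x, hx⟩ := hn
  by_cases hu : OccursIn x u
  · exact key huv hu fun hv => hx (iff_of_true hu hv)
  · have hv := by_contra fun hv => hx (iff_of_false hu hv)
    exact trans huv (trans (key (symm huv) hv hu) (mul_right (symm huv) _))

theorem mul_wpow_mem_SLvar {u w : SGWord} (h : (u, w) ∈ SLvar.theory) (N : ℕ) :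
    (u, u * wpow w N) ∈ SLvar.theory := by
  rw [mem_SLvar] at h ⊢
  simp [occursIn_wpow, h]

theorem isNeutralElt_SLvar : IsNeutralElt SLvar := by
  refine isNeutralElt_of (fun Y Z hY hZ u v huv h => ?_)
    fun Y Z D hY hZ hXY hYZ hZX u v h => ?_
  · obtain ⟨N, hN, hZN⟩ := exists_wpow_const_of_not_SLvar_le hZ
    have absorb {u v : SGWord} (h : (u, v) ∈ (Y ⊓ Z).theory) :
        (u, u * wpow u N) ∈ (Y ⊓ (Z ⊔ SLvar)).theory ∨
          ((u, v) ∈ (Y ⊓ (Z ⊔ SLvar)).theory ∧ (u, v) ∈ SLvar.theory) := by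
      refine inf_induction (fun w => (u, u * wpow u N) ∈ (Y ⊓ (Z ⊔ SLvar)).theory ∨
        ((u, w) ∈ (Y ⊓ (Z ⊔ SLvar)).theory ∧ (u, w) ∈ SLvar.theory)) ?_ ?_ h
        (.inr ⟨refl _ _, refl _ _⟩)
      · exact fun a b hab => Or.imp_right fun hu =>
          ⟨trans hu.1 (mem_inf_left hab), trans hu.2 (hY hab)⟩
      · rintro a b hab (hu | ⟨hu, hu'⟩)
        · exact .inl hu
        by_cases hs : (a, b) ∈ SLvar.theory
        · exact .inr ⟨trans hu (mem_inf_right (mem_sup.2 ⟨hab, hs⟩)), trans hu' hs⟩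
        · exact .inl (trans hu (trans (mem_inf_right (mem_sup.2
            ⟨mem_mul_wpow hN hZN hab hs u, mul_wpow_mem_SLvar (symm hu') N⟩))
            (mul_right (symm hu) _)))
    obtain hu | hu := absorb h
    swap
    · exact hu.1
    obtain hv | hv := absorb (symm h)
    swap
    · exact symm hv.1
    have hcont := mem_SLvar.1 huv
    let σ : ℕ → SGWord := fun n => open Classical in if OccursIn n u then ltr n else ltr u.head
    have hσ (n x : ℕ) (hx : OccursIn x (σ n)) : OccursIn x u := by
      simp only [σ] at hx
      split_ifs at hx with hn <;> rw [occursIn_ltr] at hx <;> subst hx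
      exacts [hn, occursIn_head u]
    have hfix (w : SGWord) (hw : ∀ n, OccursIn n w → OccursIn n u) :
        FreeSemigroup.lift σ w = w := by
      refine Eq.trans (lift_congr fun n hn => ?_) (lift_ltr_self w)
      simp [σ, hw n hn]
    have hSL (a : SGWord) : (FreeSemigroup.lift σ a * wpow u N, u) ∈ SLvar.theory := by
      refine mem_SLvar.2 fun x => ?_
      rw [occursIn_mul, occursIn_wpow, occursIn_lift]
      exact ⟨fun h => h.elim (fun ⟨m, _, hm⟩ => hσ m x hm) id, .inr⟩
    have hmid := inf_theory_subset (X := Y ⊓ (Z ⊔ SLvar))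
      (r := fun a => FreeSemigroup.lift σ a * wpow u N)
      (fun a b hab => mem_inf_left (mul_right (subst hab σ) _))
      (fun a b hab => mem_inf_right (mem_sup.2
        ⟨mul_right (subst hab σ) _, trans (hSL a) (symm (hSL b))⟩)) h
    simp only [hfix u fun _ => id, hfix v fun n => (hcont n).2] at hmid
    refine trans hu (trans hmid (trans (mul (refl _ v) ?_) (symm hv)))
    exact mem_inf_right (mem_sup.2 ⟨hZN u v, wpow_mem huv N⟩)
  · by_cases hs : (u, v) ∈ SLvar.theory
    · exact hXY (mem_sup.2 ⟨hs, h⟩)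
    obtain ⟨n, hn, hYn⟩ := exists_wpow_const_of_not_SLvar_le hY
    obtain ⟨m, hm, hZm⟩ := exists_wpow_const_of_not_SLvar_le hZ
    have hnm : 1 ≤ n * m := Nat.mul_pos hn hm
    have hYN (s t) : (wpow s (n * m), wpow t (n * m)) ∈ Y.theory :=
      mul_comm m n ▸ wpow_const_mul hn hm hYn s t
    have hconst (s t) : (wpow s (n * m), wpow t (n * m)) ∈ D.theory :=
      hYZ (mem_sup.2 ⟨hYN s t, wpow_const_mul hm hn hZm s t⟩)
    have absorb {u v : SGWord} (h : (u, v) ∈ Y.theory) (hs : (u, v) ∉ SLvar.theory)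
        (w : SGWord) : (u, u * wpow w (n * m)) ∈ D.theory :=
      trans (hXY (mem_sup.2 ⟨mul_wpow_mem_SLvar (refl _ u) (n * m),
        mem_mul_wpow hnm hYN h hs u⟩)) (mul (refl _ u) (hconst u w))
    refine trans (absorb h hs (u * v)) (trans (hXY (mem_sup.2 ⟨?_, mul_right h _⟩))
      (symm (absorb (symm h) (fun h => hs (symm h)) (u * v))))
    refine mem_SLvar.2 fun x => ?_
    simp only [occursIn_mul, occursIn_wpow]
    tauto

end ComVariety
/-! ### Varieties containing neither the semilattices nor the null semigroups -/

/-- The words `u` and `v` are equal up to commutativity or both have length at least four. -/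
def NilRel (u v : SGWord) : Prop :=
  (u, v) ∈ COMvar.theory ∨ (4 ≤ u.length ∧ 4 ≤ v.length)

/-- The relation `NilRel`, enlarged by all instances of `x²y = xy²`. -/
def NilSwapRel (u v : SGWord) : Prop :=
  NilRel u v ∨ ∃ s t, (u, s * s * t) ∈ COMvar.theory ∧ (v, s * t * t) ∈ COMvar.theory

namespace ComVariety

variable {V W : ComVariety}

theorem le_COMvar : V ≤ COMvar := fun _ hi => V.mem_of_lift_eq fun S _ f =>
  hi S (by rintro i rfl g; exact mul_comm _ _) f

theorem lift_eq_of_mem_COMvar {u v : SGWord} (h : (u, v) ∈ COMvar.theory) {S : Type}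
    [CommSemigroup S] [Nonempty S] (f : ℕ → S) :
    FreeSemigroup.lift f u = FreeSemigroup.lift f v :=
  h ⟨S⟩ (by rintro i rfl g; exact mul_comm _ _) f

theorem length_eq_of_mem_COMvar {u v : SGWord} (h : (u, v) ∈ COMvar.theory) :
    u.length = v.length := by
  have eval (w : SGWord) :
      FreeSemigroup.lift (fun _ => Multiplicative.ofAdd (1 : ℕ)) w =
        Multiplicative.ofAdd w.length := by
    induction w using FreeSemigroup.recOnMul with
    | ih1 n => rfl
    | ih2 n w _ ih =>
      rw [FreeSemigroup.lift_of_mul, ih, FreeSemigroup.length_mul, FreeSemigroup.length_of,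
        ofAdd_add]
  simpa [eval] using lift_eq_of_mem_COMvar h fun _ => Multiplicative.ofAdd (1 : ℕ)

theorem eq_ltr_of_sq_mul_mem_COMvar {s t : SGWord} {x y : ℕ} (hxy : x ≠ y)
    (h : (s * s * t, ltr x * ltr x * ltr y) ∈ COMvar.theory) : s = ltr x ∧ t = ltr y := by
  have hl := length_eq_of_mem_COMvar h
  simp only [FreeSemigroup.length_mul, ltr, FreeSemigroup.length_of] at hl
  have hs := one_le_length s
  have ht := one_le_length t
  obtain ⟨a, rfl⟩ := exists_eq_ltr_of_length_lt_two (show s.length < 2 by omega)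
  obtain ⟨b, rfl⟩ := exists_eq_ltr_of_length_lt_two (show t.length < 2 by omega)
  have count (z : ℕ) : ((if a = z then 1 else 0) + if a = z then 1 else 0) +
      (if b = z then 1 else 0) =
      ((if x = z then 1 else 0) + if x = z then 1 else 0) + if y = z then 1 else 0 :=
    congrArg Multiplicative.toAdd (lift_eq_of_mem_COMvar h fun n =>
      Multiplicative.ofAdd (if n = z then (1 : ℕ) else 0))
  have hx := count x
  have hy := count y
  simp only [if_pos, if_neg hxy, if_neg hxy.symm] at hx hy
  constructor <;> congr 1 <;> split_ifs at hx hy <;> omega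

end ComVariety

open ComVariety

theorem NilRel.symm {u v : SGWord} (h : NilRel u v) : NilRel v u :=
  h.imp ComVariety.symm And.symm

theorem NilRel.mul {u v : SGWord} (w : SGWord) (h : NilRel u v) : NilRel (u * w) (v * w) :=
  h.imp (mul_right · w) fun h => by simp only [FreeSemigroup.length_mul]; omega

theorem NilRel.subst {u v : SGWord} (σ : ℕ → SGWord) (h : NilRel u v) :
    NilRel (FreeSemigroup.lift σ u) (FreeSemigroup.lift σ v) :=
  h.imp (ComVariety.subst · σ) (And.imp (·.trans (length_le_length_lift σ u))
    (·.trans (length_le_length_lift σ v)))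

theorem NilSwapRel.symm {u v : SGWord} (h : NilSwapRel u v) : NilSwapRel v u :=
  h.imp NilRel.symm fun ⟨s, t, hu, hv⟩ =>
    ⟨t, s, ComVariety.trans hv (COMvar.mem_of_lift_eq fun _ _ _ => by simp only [map_mul]; ac_rfl),
      ComVariety.trans hu (COMvar.mem_of_lift_eq fun _ _ _ => by simp only [map_mul]; ac_rfl)⟩

theorem NilSwapRel.mul {u v : SGWord} (w : SGWord) (h : NilSwapRel u v) :
    NilSwapRel (u * w) (v * w) := by
  refine .inl (h.elim (NilRel.mul w) ?_)
  rintro ⟨s, t, hu, hv⟩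
  have hu := length_eq_of_mem_COMvar hu
  have hv := length_eq_of_mem_COMvar hv
  have := one_le_length s
  have := one_le_length t
  have := one_le_length w
  simp only [FreeSemigroup.length_mul] at hu hv
  exact .inr (by simp only [FreeSemigroup.length_mul]; omega)

theorem NilSwapRel.subst {u v : SGWord} (σ : ℕ → SGWord) (h : NilSwapRel u v) :
    NilSwapRel (FreeSemigroup.lift σ u) (FreeSemigroup.lift σ v) :=
  h.imp (NilRel.subst σ) fun ⟨s, t, hu, hv⟩ =>
    ⟨FreeSemigroup.lift σ s, FreeSemigroup.lift σ t,
      by simpa only [map_mul] using ComVariety.subst hu σ,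
      by simpa only [map_mul] using ComVariety.subst hv σ⟩

namespace ComVariety

variable {V : ComVariety}

/-- The variety `var{xyzt = 0, xy = yx}`. -/
def nilVar : ComVariety :=
  ofRel NilRel (fun _ _ => NilRel.symm) (fun _ _ w => NilRel.mul w)
    (fun u v => .inl (COMvar.mul_comm_mem u v)) fun σ _ _ => NilRel.subst σ

/-- The variety `var{xyzt = 0, x²y = xy², xy = yx}`. -/
def nilSwapVar : ComVariety :=
  ofRel NilSwapRel (fun _ _ => NilSwapRel.symm) (fun _ _ w => NilSwapRel.mul w)
    (fun u v => .inl (.inl (COMvar.mul_comm_mem u v))) fun σ _ _ => NilSwapRel.subst σ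

theorem nilSwapVar_le_nilVar : nilSwapVar ≤ nilVar := fun _ hi =>
  ReflTransGen.mono (fun _ _ => Or.inl) _ _ hi

theorem mem_COMvar_of_nilRel {u v : SGWord} (h : NilRel u v) (hu : u.length < 4) :
    (u, v) ∈ COMvar.theory := h.resolve_right fun h => by omega

theorem mem_COMvar_of_mem_nilVar {u v : SGWord} (h : (u, v) ∈ nilVar.theory)
    (hu : u.length < 4) : (u, v) ∈ COMvar.theory := by
  change ReflTransGen NilRel u v at h
  induction h with
  | refl => exact refl _ _
  | tail _ hbc ih =>
    exact trans ih (mem_COMvar_of_nilRel hbc (length_eq_of_mem_COMvar ih ▸ hu))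

theorem sq_mul_comm_mem_COMvar (s t : SGWord) : (s * t * t, t * t * s) ∈ COMvar.theory :=
  COMvar.mem_of_lift_eq fun _ _ _ => by simp only [map_mul]; ac_rfl

theorem mem_COMvar_of_mem_nilSwapVar {w : SGWord}
    (h : (ltr 0 * ltr 0 * ltr 1, w) ∈ nilSwapVar.theory) :
    (ltr 0 * ltr 0 * ltr 1, w) ∈ COMvar.theory ∨
      (ltr 1 * ltr 1 * ltr 0, w) ∈ COMvar.theory := by
  have step {x y : ℕ} (hxy : x ≠ y) {a b : SGWord} (hab : NilSwapRel a b)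
      (ha : (ltr x * ltr x * ltr y, a) ∈ COMvar.theory) :
      (ltr x * ltr x * ltr y, b) ∈ COMvar.theory ∨
        (ltr y * ltr y * ltr x, b) ∈ COMvar.theory := by
    obtain hab | ⟨s, t, hs, ht⟩ := hab
    · refine .inl (trans ha (mem_COMvar_of_nilRel hab ?_))
      rw [← length_eq_of_mem_COMvar ha]
      simp [ltr]
    · obtain ⟨rfl, rfl⟩ := eq_ltr_of_sq_mul_mem_COMvar hxy (symm (trans ha hs))
      exact .inr (symm (trans ht (sq_mul_comm_mem_COMvar _ _)))
  change ReflTransGen NilSwapRel _ w at h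
  induction h with
  | refl => exact .inl (refl _ _)
  | tail _ hbc ih => exact ih.elim (step zero_ne_one hbc) fun h => (step one_ne_zero hbc h).symm

theorem ZMvar_ne_bot : ZMvar ≠ ⊥ := by
  rw [Ne, eq_bot_iff_mem, mem_ZMvar]
  simp [ltr, FreeSemigroup.ext_iff]

theorem SLvar_ne_bot : SLvar ≠ ⊥ := by
  rw [Ne, eq_bot_iff_mem, mem_SLvar]
  exact fun h => zero_ne_one ((occursIn_ltr 0 1).1 ((h 0).1 ((occursIn_ltr 0 0).2 rfl)))

/-- A variety containing neither `SL` nor `ZM` consists of groups of bounded exponent. -/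
theorem exists_mul_wpow_mem (hZM : ¬ ZMvar ≤ V) (hSL : ¬ SLvar ≤ V) :
    ∃ N, 1 ≤ N ∧ ∀ w t, (w, w * wpow t N) ∈ V.theory := by
  obtain ⟨k, hk, hpow⟩ := exists_wpow_mem_of_not_ZMvar_le hZM
  obtain ⟨N, hN, hconst⟩ := exists_wpow_const_of_not_SLvar_le hSL
  obtain ⟨m, rfl⟩ := Nat.exists_eq_add_of_le' (show 1 ≤ k by omega)
  have hm : 1 ≤ m := by omega
  have hmN : 1 ≤ m * N := Nat.mul_pos hm hN
  refine ⟨m * N, hmN, fun w t => trans (wpow_mem_of_wpow_mem hpow N w) (trans ?_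
    (mul (refl _ w) (wpow_const_mul hN hm hconst w t)))⟩
  refine mem_of_coe_lift_eq fun S _ f => ?_
  rw [map_mul, WithOne.coe_mul, coe_lift_wpow f w hmN, coe_lift_wpow f w (Nat.le_add_left 1 _),
    mul_comm N m, pow_succ']

theorem eq_bot_of_sq_mul_mem {N : ℕ} (hN : 1 ≤ N) (h : ∀ w t, (w, w * wpow t N) ∈ V.theory)
    (hV : (ltr 0 * ltr 0 * ltr 1, ltr 1 * ltr 1 * ltr 0) ∈ V.theory) : V = ⊥ := by
  refine eq_bot_iff_mem.2 (mem_of_coe_lift_eq fun S hS f => ?_)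
  have hunit (w t : SGWord) := congrArg (WithOne.coe : S.carrier → WithOne S.carrier)
    (lift_eq (h w t) hS f)
  have hswap := congrArg (WithOne.coe : S.carrier → WithOne S.carrier) (lift_eq hV hS f)
  simp only [map_mul, WithOne.coe_mul, coe_lift_wpow f _ hN] at hunit hswap
  obtain ⟨n, rfl⟩ := Nat.exists_eq_add_of_le' hN
  have h₀₀ := hunit (ltr 0) (ltr 0)
  have h₀₁ := hunit (ltr 0) (ltr 1)
  have h₁₀ := hunit (ltr 1) (ltr 0)
  have h₁₁ := hunit (ltr 1) (ltr 1)
  clear hunit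
  generalize ((FreeSemigroup.lift f (ltr 0) : S.carrier) : WithOne S.carrier) = a at *
  generalize ((FreeSemigroup.lift f (ltr 1) : S.carrier) : WithOne S.carrier) = b at *
  calc a = a * a ^ (n + 1) * b ^ (n + 1) := by rw [← h₀₀, ← h₀₁]
    _ = a * a * b * (a ^ n * b ^ n) := by rw [pow_succ, pow_succ]; ac_rfl
    _ = b * b * a * (a ^ n * b ^ n) := by rw [hswap]
    _ = b * b ^ (n + 1) * a ^ (n + 1) := by rw [pow_succ, pow_succ]; ac_rfl
    _ = b := by rw [← h₁₁, ← h₁₀]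

theorem eq_bot_of_isNeutralElt (hZM : ¬ ZMvar ≤ V) (hSL : ¬ SLvar ≤ V) (hn : IsNeutralElt V) :
    V = ⊥ := by
  obtain ⟨N, hN, hunit⟩ := exists_mul_wpow_mem hZM hSL
  have hbot : V ⊓ nilVar = ⊥ := by
    have key (w : SGWord) :
        (w, w * wpow w N * wpow w N * wpow w N) ∈ (V ⊓ nilVar).theory :=
      mem_inf_left (trans (hunit _ w) (trans (hunit _ w) (hunit _ w)))
    refine eq_bot_iff_mem.2 (trans (key _) (trans (mem_inf_right (.single (.inr ?_)))
      (symm (key _))))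
    constructor <;> simp only [FreeSemigroup.length_mul, length_wpow _ hN] <;>
      simp only [ltr, FreeSemigroup.length_of] <;> omega
  have hle : nilVar ⊓ (nilSwapVar ⊔ V) ≤ nilSwapVar := by
    calc nilVar ⊓ (nilSwapVar ⊔ V)
        ≤ (V ⊔ nilVar) ⊓ (nilVar ⊔ nilSwapVar) ⊓ (nilSwapVar ⊔ V) :=
          inf_le_inf_right _ (le_inf le_sup_right le_sup_left)
      _ = (V ⊓ nilVar) ⊔ (nilVar ⊓ nilSwapVar) ⊔ (nilSwapVar ⊓ V) := hn _ _
      _ ≤ nilSwapVar := sup_le (sup_le (hbot.le.trans bot_le) inf_le_right) inf_le_left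
  have hmem : (ltr 0 * ltr 0 * ltr 1, ltr 1 * ltr 1 * ltr 0) ∈ nilSwapVar.theory :=
    .single (.inr ⟨ltr 0, ltr 1, refl _ _, symm (sq_mul_comm_mem_COMvar _ _)⟩)
  by_contra hV
  have hcontra : (ltr 0 * ltr 0 * ltr 1, ltr 1 * ltr 1 * ltr 0) ∈ COMvar.theory := by
    refine inf_induction (fun w => (ltr 0 * ltr 0 * ltr 1, w) ∈ COMvar.theory)
      (fun a b hab ha => trans ha (mem_COMvar_of_mem_nilVar hab ?_)) (fun a b hab ha => ?_)
      (hle hmem) (refl _ _)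
    · rw [← length_eq_of_mem_COMvar ha]
      simp [ltr]
    · obtain ⟨hab, hab'⟩ := mem_sup.1 hab
      refine (mem_COMvar_of_mem_nilSwapVar (trans (le_COMvar ha) hab)).resolve_right fun hb => ?_
      exact hV (eq_bot_of_sq_mul_mem hN hunit
        (trans (le_COMvar ha) (trans hab' (symm (le_COMvar hb)))))
  have := (eq_ltr_of_sq_mul_mem_COMvar one_ne_zero hcontra).1
  simp [ltr, FreeSemigroup.ext_iff] at this

end ComVariety
/-- **Corollary.** An atom of the lattice **Com** is a neutral element of this lattice
if and only if it coincides with one of the varieties `SL` or `ZM`. -/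
theorem neutral_atoms_of_Com (V : ComVariety) (hV : IsAtom V) :
    IsNeutralElt V ↔ V = SLvar ∨ V = ZMvar := by
  constructor
  · intro hn
    by_contra! h
    have hZM : ¬ ZMvar ≤ V := fun hle =>
      (hV.le_iff.1 hle).elim ComVariety.ZMvar_ne_bot fun he => h.2 he.symm
    have hSL : ¬ SLvar ≤ V := fun hle =>
      (hV.le_iff.1 hle).elim ComVariety.SLvar_ne_bot fun he => h.1 he.symm
    exact hV.1 (ComVariety.eq_bot_of_isNeutralElt hZM hSL hn)
  · rintro (rfl | rfl)
    exacts [ComVariety.isNeutralElt_SLvar, ComVariety.isNeutralElt_ZMvar]
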